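/- x(n) = α₀(n) − ⌊α₀(n)⌋ + o(1); that is, x(n) − (α₀(n) − ⌊α₀(n)⌋) → 0 as n → ∞. In particular x(n) ∈ [o(1), 1 + o(1)]. -/

import Mathlib

open Filter

/-- `α₀(n) = 2 log₂ n − 2 log₂ log₂ n + 2 log₂ (e/2) + 1`. -/
noncomputable def alpha0 (n : ℕ) : ℝ :=
  2 * Real.logb 2 n - 2 * Real.logb 2 (Real.logb 2 n)
    + 2 * Real.logb 2 (Real.exp 1 / 2) + 1

/-- `a(n) = ⌊α₀(n)⌋`. -/
noncomputable def aa (n : ℕ) : ℕ := ⌊alpha0 n⌋₊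

/-- `μ(n) = C(n, a(n)) · 2^{−a(n)(a(n)−1)/2}`. -/
noncomputable def mu (n : ℕ) : ℝ :=
  (n.choose (aa n) : ℝ) * (2 : ℝ)⁻¹ ^ ((aa n).choose 2)

/-- `x(n) = log μ(n) / log n`, so that `μ(n) = n^{x(n)}`. -/
noncomputable def xx (n : ℕ) : ℝ := Real.log (mu n) / Real.log n

lemma aux_L : Tendsto (fun n : ℕ => Real.log n) atTop atTop :=
  Real.tendsto_log_atTop.comp tendsto_natCast_atTop_atTop

lemma aux_E : Tendsto (fun k : ℕ => Real.log (k.factorial) / k - Real.log k + 1) atTop (nhds 0) := by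
  have h1 : Tendsto (fun k : ℕ => Real.log (Stirling.stirlingSeq k)) atTop
      (nhds (Real.log (√Real.pi))) :=
    (Stirling.tendsto_stirlingSeq_sqrt_pi).log (by positivity)
  have hN : Tendsto (fun k : ℕ => (k : ℝ)) atTop atTop := tendsto_natCast_atTop_atTop
  have h2 : Tendsto (fun k : ℕ => Real.log (Stirling.stirlingSeq k) / k) atTop (nhds 0) :=
    h1.div_atTop hN
  have h3 : Tendsto (fun k : ℕ => Real.log k / k) atTop (nhds 0) := by
    have := (Real.isLittleO_log_id_atTop.tendsto_div_nhds_zero).comp hN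
    simpa [Function.comp_def] using this
  have h4 : Tendsto (fun k : ℕ => Real.log 2 / k) atTop (nhds 0) :=
    tendsto_const_nhds.div_atTop hN
  have h5 := (h2.add ((h3.add h4).const_mul (1/2)))
  simp only [add_zero, mul_zero] at h5
  refine h5.congr' ?_
  filter_upwards [eventually_gt_atTop 0] with k hk
  have hk' : (0:ℝ) < k := by exact_mod_cast hk
  rw [Stirling.log_stirlingSeq_formula, Real.log_mul (by norm_num) hk'.ne',
    Real.log_div hk'.ne' (Real.exp_pos 1).ne', Real.log_exp]
  field_simp
  ring

lemma alpha0_eq {n : ℕ} (hn : 0 < Real.log n) : alpha0 n = 2 / Real.log 2 *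
    (Real.log n - Real.log (Real.log n) + Real.log (Real.log 2) + 1 - Real.log 2) + 1 := by
  have h2 : 0 < Real.log 2 := Real.log_pos (by norm_num)
  unfold alpha0 Real.logb
  rw [Real.log_div hn.ne' h2.ne', Real.log_div (Real.exp_pos 1).ne' (by norm_num), Real.log_exp]
  field_simp
  ring

lemma alpha_lim : Tendsto (fun n : ℕ => alpha0 n / Real.log n) atTop (nhds (2 / Real.log 2)) := by
  have h3 : Tendsto (fun n : ℕ => Real.log (Real.log n) / Real.log n) atTop (nhds 0) := by
    have := (Real.isLittleO_log_id_atTop.tendsto_div_nhds_zero).comp aux_L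
    simpa [Function.comp_def] using this
  have h4 : Tendsto (fun n : ℕ => (2 / Real.log 2 * (Real.log (Real.log 2) + 1 - Real.log 2) + 1)
      / Real.log n) atTop (nhds 0) := tendsto_const_nhds.div_atTop aux_L
  have h5 := ((h3.const_mul (2 / Real.log 2)).const_sub (2 / Real.log 2)).add h4
  simp only [add_zero, mul_zero, sub_zero] at h5
  refine h5.congr' ?_
  filter_upwards [aux_L.eventually_gt_atTop 0] with n hn
  rw [alpha0_eq hn]
  field_simp
  ring

lemma alpha_top : Tendsto alpha0 atTop atTop := by
  have h2 : 0 < Real.log 2 := Real.log_pos (by norm_num)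
  have := alpha_lim.pos_mul_atTop (by positivity) aux_L
  refine this.congr' ?_
  filter_upwards [aux_L.eventually_gt_atTop 0] with n hn
  field_simp

lemma frac_bd : ∀ᶠ n : ℕ in atTop, 0 ≤ alpha0 n - aa n ∧ alpha0 n - aa n ≤ 1 := by
  filter_upwards [alpha_top.eventually_ge_atTop 0] with n hn
  have h1 := Nat.floor_le hn
  have h2 := Nat.lt_floor_add_one (alpha0 n)
  unfold aa
  constructor <;> linarith

lemma aa_top : Tendsto aa atTop atTop := tendsto_nat_floor_atTop.comp alpha_top

lemma aa_lim : Tendsto (fun n : ℕ => (aa n : ℝ) / Real.log n) atTop (nhds (2 / Real.log 2)) := by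
  have h1 : Tendsto (fun n : ℕ => 1 / Real.log n) atTop (nhds 0) :=
    tendsto_const_nhds.div_atTop aux_L
  have h2 := alpha_lim.sub h1
  rw [sub_zero] at h2
  refine tendsto_of_tendsto_of_tendsto_of_le_of_le' h2 alpha_lim ?_ ?_
  · filter_upwards [aux_L.eventually_gt_atTop 0, frac_bd] with n hn hf
    rw [← sub_div]
    gcongr
    linarith
  · filter_upwards [aux_L.eventually_gt_atTop 0, frac_bd] with n hn hf
    gcongr
    linarith

lemma aa_n : Tendsto (fun n : ℕ => (aa n : ℝ) / n) atTop (nhds 0) := by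
  have hN : Tendsto (fun k : ℕ => (k : ℝ)) atTop atTop := tendsto_natCast_atTop_atTop
  have h3 : Tendsto (fun k : ℕ => Real.log k / k) atTop (nhds 0) := by
    have := (Real.isLittleO_log_id_atTop.tendsto_div_nhds_zero).comp hN
    simpa [Function.comp_def] using this
  have := aa_lim.mul h3
  rw [mul_zero] at this
  refine this.congr' ?_
  filter_upwards [aux_L.eventually_gt_atTop 0] with n hn
  field_simp

lemma aa_le : ∀ᶠ n : ℕ in atTop, aa n < n := by
  filter_upwards [aa_n.eventually_lt_const one_pos, eventually_gt_atTop 0] with n h hn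
  have hn' : (0:ℝ) < n := by exact_mod_cast hn
  rw [div_lt_one hn'] at h
  exact_mod_cast h

lemma D_lim : Tendsto (fun n : ℕ => Real.log (n.descFactorial (aa n)) / aa n - Real.log n)
    atTop (nhds 0) := by
  have h1 : Tendsto (fun n : ℕ => Real.log (1 - (aa n : ℝ) / n)) atTop (nhds 0) := by
    have := (aa_n.const_sub 1).log (by norm_num)
    simpa using this
  refine tendsto_of_tendsto_of_tendsto_of_le_of_le' h1 tendsto_const_nhds ?_ ?_
  · filter_upwards [aa_le, aa_top.eventually_gt_atTop 0] with n h h0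
    have h0' : (0:ℝ) < aa n := by exact_mod_cast h0
    have hn' : (aa n:ℝ) < n := by exact_mod_cast h
    have hn : (0:ℝ) < n := by linarith
    have e : (1 - (aa n : ℝ) / n) = (n - aa n) / n := by field_simp
    rw [e, Real.log_div (by linarith) hn.ne']
    gcongr
    rw [le_div_iff₀ h0', mul_comm, ← Real.log_pow]
    apply Real.log_le_log (by have : (0:ℝ) < n - aa n := by linarith
                              positivity)
    have h5 : (n - aa n) ^ aa n ≤ n.descFactorial (aa n) :=
      (Nat.pow_le_pow_left (by omega) _).trans (Nat.pow_sub_le_descFactorial n (aa n))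
    have h6 : (((n - aa n) ^ aa n : ℕ) : ℝ) ≤ n.descFactorial (aa n) := by exact_mod_cast h5
    rwa [Nat.cast_pow, Nat.cast_sub h.le] at h6
  · filter_upwards [aa_le, aa_top.eventually_gt_atTop 0] with n h h0
    have h0' : (0:ℝ) < aa n := by exact_mod_cast h0
    rw [sub_nonpos, div_le_iff₀ h0', mul_comm, ← Real.log_pow]
    apply Real.log_le_log
    · exact_mod_cast Nat.descFactorial_pos.2 h.le
    · exact_mod_cast Nat.descFactorial_le_pow n (aa n)

lemma log_mu {n : ℕ} (h : aa n < n) : Real.log (mu n) =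
    Real.log (n.descFactorial (aa n)) - Real.log ((aa n).factorial)
      - (aa n * (aa n - 1) / 2) * Real.log 2 := by
  have h1 : (0:ℝ) < n.choose (aa n) := by exact_mod_cast Nat.choose_pos h.le
  have h2 : (0:ℝ) < (aa n).factorial := by exact_mod_cast Nat.factorial_pos _
  unfold mu
  rw [Real.log_mul h1.ne' (by positivity), Real.log_pow, Real.log_inv, Nat.cast_choose_two,
    Nat.descFactorial_eq_factorial_mul_choose, Nat.cast_mul, Real.log_mul h2.ne' h1.ne']
  ring

lemma main_lim : Tendsto (fun n : ℕ => xx n - (alpha0 n - (aa n : ℝ))) atTop (nhds 0) := by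
  have hl2 : 0 < Real.log 2 := Real.log_pos (by norm_num)
  have hE := aux_E.comp aa_top
  have hlog := aa_lim.log (by positivity)
  have heps := (D_lim.sub hE).sub (hlog.sub_const (Real.log (2 / Real.log 2)))
  rw [sub_self, sub_self, sub_zero] at heps
  have t1 := aa_lim.mul heps
  rw [mul_zero] at t1
  have t2 : Tendsto (fun n : ℕ => (aa n : ℝ) / Real.log n * (Real.log 2 / 2) - 1) atTop
      (nhds 0) := by
    have := (aa_lim.mul_const (Real.log 2 / 2)).sub_const 1
    convert this using 2
    field_simp
    norm_num
  have t3 : Tendsto (fun n : ℕ => ((aa n : ℝ) / Real.log n * (Real.log 2 / 2) - 1)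
      * (alpha0 n - aa n)) atTop (nhds 0) := by
    refine squeeze_zero_norm' ?_ (by simpa using t2.abs)
    filter_upwards [frac_bd] with n hf
    rw [Real.norm_eq_abs, abs_mul, abs_of_nonneg hf.1]
    exact mul_le_of_le_one_right (abs_nonneg _) hf.2
  have t4 := t1.add t3
  rw [add_zero] at t4
  refine t4.congr' ?_
  filter_upwards [aa_le, aa_top.eventually_gt_atTop 0, aux_L.eventually_gt_atTop 0] with n h h0 hL
  have h0' : (0:ℝ) < aa n := by exact_mod_cast h0
  have ha := alpha0_eq hL
  simp only [Function.comp]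
  unfold xx
  rw [log_mu h, Real.log_div h0'.ne' hL.ne', Real.log_div (by norm_num) hl2.ne', ha]
  field_simp
  ring

/-- `x(n) = α₀(n) − ⌊α₀(n)⌋ + o(1)`; in particular `x(n) ∈ [o(1), 1 + o(1)]`. -/
theorem stmt5 :
    Tendsto (fun n : ℕ => xx n - (alpha0 n - (aa n : ℝ))) atTop (nhds 0) ∧
    ∃ g h : ℕ → ℝ, Tendsto g atTop (nhds 0) ∧ Tendsto h atTop (nhds 0) ∧
      ∀ n : ℕ, g n ≤ xx n ∧ xx n ≤ 1 + h n := by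
  refine ⟨main_lim, fun n => min (xx n) 0, fun n => max (xx n - 1) 0, ?_, ?_, ?_⟩
  · refine squeeze_zero_norm' ?_ (by simpa using main_lim.abs)
    filter_upwards [frac_bd] with n hf
    have := neg_abs_le (xx n - (alpha0 n - (aa n : ℝ)))
    rw [Real.norm_eq_abs, abs_of_nonpos (min_le_right _ _), neg_le]
    exact le_min (by linarith) (by simp)
  · refine squeeze_zero_norm' ?_ (by simpa using main_lim.abs)
    filter_upwards [frac_bd] with n hf
    have := le_abs_self (xx n - (alpha0 n - (aa n : ℝ)))
    rw [Real.norm_eq_abs, abs_of_nonneg (le_max_right _ _)]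
    exact max_le (by linarith) (by simp)
  · intro n
    refine ⟨min_le_left _ _, ?_⟩
    have := le_max_left (xx n - 1) 0
    linarith
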